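/- Let X be a first countable, locally compact, paracompact Hausdorff topological space, f : X → X a topologically expansive homeomorphism, and A a proper expansive neighborhood for f. For each N ∈ ℕ define V_N(A) = {(x,y) ∈ X × X : F^n(x,y) ∈ A for all n ∈ ℤ with |n| ≤ N}. Then: (i) for every wide neighborhood U of Δ_X there exists N ∈ ℕ with V_N(A) ⊆ U; and (ii) for every N ∈ ℕ there exists a neighborhood U of Δ_X with U ⊆ V_N(A). -/

import Mathlib

open Set Topology

namespace TopAnosovPaper

variable {X Y : Type*}

section Defs

variable [TopologicalSpace X]

/-- The `n`-th iterate (n ∈ ℤ) of a homeomorphism, as a function. -/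
def iter (f : X ≃ₜ X) (n : ℤ) : X → X := ⇑(f.toEquiv ^ n)

/-- `N` is an expansive neighborhood for `f`: a closed neighborhood of the
diagonal such that any two distinct points are eventually separated by `F = f × f`. -/
def IsExpansiveNbhd (f : X ≃ₜ X) (N : Set (X × X)) : Prop :=
  IsClosed N ∧ N ∈ nhdsSet (Set.diagonal X) ∧
    ∀ x y : X, x ≠ y → ∃ n : ℤ, (iter f n x, iter f n y) ∉ N

/-- `f` is topologically expansive. -/
def TopExpansive (f : X ≃ₜ X) : Prop := ∃ N : Set (X × X), IsExpansiveNbhd f N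

/-- A `D`-pseudo-orbit: a bi-infinite sequence with `(f x_{i-1}, x_i) ∈ D`. -/
def IsPseudoOrbit (f : X ≃ₜ X) (D : Set (X × X)) (x : ℤ → X) : Prop :=
  ∀ i : ℤ, (f (x (i - 1)), x i) ∈ D

/-- `y` `E`-traces the bi-infinite sequence `x`. -/
def Traces (f : X ≃ₜ X) (E : Set (X × X)) (y : X) (x : ℤ → X) : Prop :=
  ∀ i : ℤ, (iter f i y, x i) ∈ E

/-- `f` has the topological shadowing property. -/
def TopShadowing (f : X ≃ₜ X) : Prop :=
  ∀ E ∈ nhdsSet (Set.diagonal X), ∃ D ∈ nhdsSet (Set.diagonal X),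
    ∀ x : ℤ → X, IsPseudoOrbit f D x → ∃ y : X, Traces f E y x

/-- `f` is topologically Anosov: expansive with the shadowing property. -/
def TopAnosov (f : X ≃ₜ X) : Prop := TopExpansive f ∧ TopShadowing f

/-- An `A`-chain from `x` to `y` (of length `n ≥ 1`). -/
def IsChainFromTo (f : X ≃ₜ X) (A : Set (X × X)) (x y : X) : Prop :=
  ∃ n : ℕ, 1 ≤ n ∧ ∃ c : ℕ → X, c 0 = x ∧ c n = y ∧
    ∀ i : ℕ, 1 ≤ i → i ≤ n → (f (c (i - 1)), c i) ∈ A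

/-- `x ∼ y`: for every neighborhood `A` of the diagonal there is an `A`-chain
from `x` to `y` and one from `y` to `x`. -/
def ChainRel (f : X ≃ₜ X) (x y : X) : Prop :=
  ∀ A ∈ nhdsSet (Set.diagonal X), IsChainFromTo f A x y ∧ IsChainFromTo f A y x

/-- The chain recurrent set. -/
def CR (f : X ≃ₜ X) : Set X := {x | ChainRel f x x}

/-- `R` is a chain component: an equivalence class of `∼` restricted to `CR f`. -/
def IsChainComponent (f : X ≃ₜ X) (R : Set X) : Prop :=
  ∃ x ∈ CR f, R = {y | y ∈ CR f ∧ ChainRel f x y}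

/-- The non-wandering set of `f`. -/
def NonWandering (f : X ≃ₜ X) : Set X :=
  {x | ∀ G : Set X, IsOpen G → x ∈ G → ∃ n : ℕ, 0 < n ∧ (iter f n '' G ∩ G).Nonempty}

/-- `x` is a periodic point of `f`. -/
def Periodic (f : X ≃ₜ X) (x : X) : Prop := ∃ n : ℕ, 0 < n ∧ iter f n x = x

/-- The set of periodic points of `f`. -/
def Per (f : X ≃ₜ X) : Set X := {x | Periodic f x}

/-- A relation `M ⊆ X × X` is proper if `M[S]` is compact for every compact `S`. -/
def IsProperRel (M : Set (X × X)) : Prop :=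
  ∀ S : Set X, IsCompact S → IsCompact {y : X | ∃ x ∈ S, (x, y) ∈ M}

/-- A set `U ⊆ X × X` is wide if `U ∪ (S × X) = X × X` for some compact `S`. -/
def IsWide (U : Set (X × X)) : Prop :=
  ∃ S : Set X, IsCompact S ∧ U ∪ (S ×ˢ (Set.univ : Set X)) = Set.univ

/-- `E` is symmetric. -/
def SymmRel (E : Set (X × X)) : Prop := ∀ p : X × X, p ∈ E → (p.2, p.1) ∈ E

/-- `E² = {(x,y) : ∃ z, (x,z) ∈ E ∧ (z,y) ∈ E}`. -/
def sq (E : Set (X × X)) : Set (X × X) := {p : X × X | ∃ z : X, (p.1, z) ∈ E ∧ (z, p.2) ∈ E}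

/-- The local stable set of `x` relative to `B`. -/
def WsLoc (f : X ≃ₜ X) (B : Set (X × X)) (x : X) : Set X :=
  {y | ∀ i : ℤ, 0 ≤ i → (iter f i x, iter f i y) ∈ B}

/-- The local unstable set of `x` relative to `B`. -/
def WuLoc (f : X ≃ₜ X) (B : Set (X × X)) (x : X) : Set X :=
  {y | ∀ i : ℤ, i ≤ 0 → (iter f i x, iter f i y) ∈ B}

/-- The stable set of `x`. -/
def Ws (f : X ≃ₜ X) (x : X) : Set X :=
  {y | ∀ B ∈ nhdsSet (Set.diagonal X), ∃ n : ℕ, ∀ i : ℤ, (n : ℤ) ≤ i →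
    (iter f i x, iter f i y) ∈ B}

/-- The unstable set of `x`. -/
def Wu (f : X ≃ₜ X) (x : X) : Set X :=
  {y | ∀ B ∈ nhdsSet (Set.diagonal X), ∃ n : ℕ, ∀ i : ℤ, i ≤ -(n : ℤ) →
    (iter f i x, iter f i y) ∈ B}

/-- `f` restricted to `R` is topologically transitive: for any nonempty
relatively open subsets `G, H` of `R` there is `n ∈ ℕ` with `f^n(G) ∩ H ≠ ∅`. -/
def TransitiveOn (f : X ≃ₜ X) (R : Set X) : Prop :=
  ∀ G H : Set X, (∃ U : Set X, IsOpen U ∧ G = U ∩ R) → (∃ V : Set X, IsOpen V ∧ H = V ∩ R) →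
    G.Nonempty → H.Nonempty → ∃ n : ℕ, (iter f n '' G ∩ H).Nonempty

/-- `V_N(A)`: pairs whose first `N` forward and backward iterates all lie in `A`. -/
def VN (f : X ≃ₜ X) (A : Set (X × X)) (N : ℕ) : Set (X × X) :=
  {p : X × X | ∀ n : ℤ, |n| ≤ (N : ℤ) → (iter f n p.1, iter f n p.2) ∈ A}

/-- The `n`-th power (n ∈ ℕ) of a homeomorphism. -/
def hpowNat (f : X ≃ₜ X) : ℕ → X ≃ₜ X
  | 0 => Homeomorph.refl X
  | n + 1 => (hpowNat f n).trans f

/-- The `k`-th power (k ∈ ℤ) of a homeomorphism, as a homeomorphism. -/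
def hpow (f : X ≃ₜ X) : ℤ → X ≃ₜ X
  | Int.ofNat n => hpowNat f n
  | Int.negSucc n => (hpowNat f (n + 1)).symm

end Defs

end TopAnosovPaper

open TopAnosovPaper

namespace TopAnosovPaper

theorem continuous_iter {X : Type*} [TopologicalSpace X] (f : X ≃ₜ X) (n : ℤ) :
    Continuous (iter f n) := by
  unfold iter
  induction n with
  | zero => exact continuous_id
  | succ n ih =>
    rw [zpow_add_one]
    exact ih.comp f.continuous
  | pred n ih =>
    rw [zpow_sub_one]
    exact ih.comp f.symm.continuous

theorem continuous_iter_prodMap {X : Type*} [TopologicalSpace X] (f : X ≃ₜ X) (n : ℤ) :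
    Continuous fun p : X × X => (iter f n p.1, iter f n p.2) :=
  ((continuous_iter f n).comp continuous_fst).prodMk ((continuous_iter f n).comp continuous_snd)

theorem VN_eq_iInter {X : Type*} [TopologicalSpace X] (f : X ≃ₜ X) (A : Set (X × X)) (N : ℕ) :
    VN f A N = ⋂ n ∈ Set.Icc (-(N : ℤ)) N, (fun p : X × X => (iter f n p.1, iter f n p.2)) ⁻¹' A := by
  ext p
  simp [VN, abs_le]

theorem isClosed_VN {X : Type*} [TopologicalSpace X] (f : X ≃ₜ X) {A : Set (X × X)}
    (hA : IsClosed A) (N : ℕ) : IsClosed (VN f A N) := by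
  rw [VN_eq_iInter]
  exact isClosed_biInter fun n _ => hA.preimage (continuous_iter_prodMap f n)

theorem VN_mem_nhdsSet_diagonal {X : Type*} [TopologicalSpace X] (f : X ≃ₜ X) {A : Set (X × X)}
    (hA : A ∈ nhdsSet (Set.diagonal X)) (N : ℕ) : VN f A N ∈ nhdsSet (Set.diagonal X) := by
  rw [VN_eq_iInter, Filter.biInter_mem (Set.finite_Icc _ _)]
  intro n _
  refine (continuous_iter_prodMap f n).tendsto_nhdsSet ?_ hA
  rintro ⟨x, y⟩ (rfl : x = y)
  rfl

theorem VN_antitone {X : Type*} [TopologicalSpace X] (f : X ≃ₜ X) (A : Set (X × X)) :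
    Antitone (VN f A) :=
  fun _ _ hMN _ hp n hn => hp n (hn.trans (by exact_mod_cast hMN))

theorem VN_subset {X : Type*} [TopologicalSpace X] (f : X ≃ₜ X) (A : Set (X × X)) (N : ℕ) :
    VN f A N ⊆ A :=
  fun _ hp => hp 0 (by simp)

theorem iInter_VN_subset_diagonal {X : Type*} [TopologicalSpace X] {f : X ≃ₜ X} {A : Set (X × X)}
    (hA : IsExpansiveNbhd f A) : ⋂ N, VN f A N ⊆ Set.diagonal X := by
  rintro ⟨x, y⟩ hp
  by_contra hxy
  obtain ⟨n, hn⟩ := hA.2.2 x y hxy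
  exact hn (Set.mem_iInter.1 hp n.natAbs n (by simp))

end TopAnosovPaper

/-- For a proper expansive neighborhood `A`: (i) every wide neighborhood of
the diagonal contains some `V_N(A)`; (ii) every `V_N(A)` contains a neighborhood of the
diagonal. -/
theorem vN_lemma {X : Type*} [TopologicalSpace X]
    [FirstCountableTopology X] [LocallyCompactSpace X] [ParacompactSpace X] [T2Space X]
    (f : X ≃ₜ X) (hf : TopExpansive f)
    (A : Set (X × X)) (hA : IsExpansiveNbhd f A) (hAp : IsProperRel A) :
    (∀ U : Set (X × X), IsWide U → U ∈ nhdsSet (Set.diagonal X) →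
      ∃ N : ℕ, VN f A N ⊆ U) ∧
    (∀ N : ℕ, ∃ U ∈ nhdsSet (Set.diagonal X), U ⊆ VN f A N) := by
  refine ⟨fun U ⟨S, hS, hSU⟩ hU => ?_,
    fun N => ⟨VN f A N, VN_mem_nhdsSet_diagonal f hA.2.1 N, Subset.rfl⟩⟩
  have hK : IsCompact ((S ×ˢ {y : X | ∃ x ∈ S, (x, y) ∈ A}) \ interior U) :=
    (hS.prod (hAp S hS)).diff isOpen_interior
  obtain ⟨N, hN⟩ := hK.elim_directed_family_closed (VN f A)
    (isClosed_VN f hA.1) (by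
      refine Set.eq_empty_of_forall_notMem fun p ⟨⟨_, hpU⟩, hp⟩ => hpU ?_
      exact subset_interior_iff_mem_nhdsSet.2 hU (iInter_VN_subset_diagonal hA hp))
    (VN_antitone f A).directed_ge
  refine ⟨N, fun p hp => ?_⟩
  by_contra hpU
  have hpS : p.1 ∈ S := by
    have : p ∈ U ∪ S ×ˢ Set.univ := hSU ▸ Set.mem_univ p
    exact (this.resolve_left hpU).1
  exact (hN.subset ⟨⟨⟨hpS, p.1, hpS, VN_subset f A N hp⟩,
    fun h => hpU (interior_subset h)⟩, hp⟩ : p ∈ (∅ : Set (X × X)))
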